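/- For all n ∈ ℕ and indices 1 ≤ i ≤ j ≤ n+1, the following equality of permutations of [n+2] holds (diagrammatic composition): (σ_2;σ_3;…;σ_j);σ_{(i)} = σ_{(i+1)};σ_{(j+1)}, where all permutations are taken in [n+2] and the composite σ_2;…;σ_j is interpreted as the identity when j = 1. Both sides equal the map φ given by φ(1) = i, φ(2) = j+1, φ(x) = x−2 for 3 ≤ x ≤ i+1, φ(x) = x−1 for i+1 < x ≤ j+1, and φ(x) = x for x > j+1. -/

import Mathlib

/-- The symmetry `σ^n_i : [n] → [n]`, the transposition exchanging `i` and `i+1` (1-based),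
i.e. the transposition of `i−1` and `i` in 0-based terms.  Requires `1 ≤ i ≤ n−1`. -/
def sigmaF (n i : ℕ) (h1 : 1 ≤ i) (h2 : i + 1 ≤ n) : Fin n → Fin n :=
  Equiv.swap ⟨i - 1, by omega⟩ ⟨i, by omega⟩

/-- The cycle `σ^n_{(i)} = (i (i−1) ⋯ 3 2 1) : [n] → [n]` (1-based: `1 ↦ i`,
`x ↦ x−1` for `2 ≤ x ≤ i`, `x ↦ x` for `x > i`), written 0-based on `Fin`.
Requires `1 ≤ i ≤ n`. -/
def sigmaCycleF (n i : ℕ) (h1 : 1 ≤ i) (h2 : i ≤ n) : Fin n → Fin n := fun x =>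
  if x.val = 0 then ⟨i - 1, by omega⟩
  else if x.val < i then ⟨x.val - 1, by have := x.isLt; omega⟩
  else x

/-- The diagrammatic composite `σ_2 ; σ_3 ; ⋯ ; σ_j : [n] → [n]`, interpreted as the
identity when `j ≤ 1`. -/
def sigmaChain (n : ℕ) : (j : ℕ) → j + 1 ≤ n → Fin n → Fin n
  | 0, _ => id
  | 1, _ => id
  | (j + 2), h => sigmaF n (j + 2) (by omega) h ∘ sigmaChain n (j + 1) (by omega)

theorem sigmaF_val (n i : ℕ) (h1 : 1 ≤ i) (h2 : i + 1 ≤ n) (x : Fin n) :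
    (sigmaF n i h1 h2 x).val =
      if x.val = i - 1 then i else if x.val = i then i - 1 else x.val := by
  simp only [sigmaF, Equiv.swap_apply_def, Fin.ext_iff]
  split_ifs <;> rfl

theorem sigmaCycleF_val (n i : ℕ) (h1 : 1 ≤ i) (h2 : i ≤ n) (x : Fin n) :
    (sigmaCycleF n i h1 h2 x).val =
      if x.val = 0 then i - 1 else if x.val < i then x.val - 1 else x.val := by
  unfold sigmaCycleF
  split_ifs <;> rfl

theorem sigmaChain_succ (n j : ℕ) (h1 : 1 ≤ j) (h2 : j + 1 + 1 ≤ n) :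
    sigmaChain n (j + 1) h2 =
      sigmaF n (j + 1) (by omega) h2 ∘ sigmaChain n j (by omega) := by
  cases j with
  | zero => omega
  | succ k => rfl

/-- The composite `σ_2 ; ⋯ ; σ_j` is, in 0-based terms, the cycle `1 ↦ j`, `x ↦ x - 1` for
`2 ≤ x ≤ j`. -/
theorem sigmaChain_val (n j : ℕ) (h1 : 1 ≤ j) (h2 : j + 1 ≤ n) (x : Fin n) :
    (sigmaChain n j h2 x).val =
      if x.val = 0 then 0 else if x.val = 1 then j
      else if x.val ≤ j then x.val - 1 else x.val := by
  induction j, h1 using Nat.le_induction with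
  | base =>
    simp only [sigmaChain, id_eq]
    split_ifs <;> omega
  | succ j hj ih =>
    have chain_val := ih (by omega)
    rw [sigmaChain_succ n j hj, Function.comp_apply, sigmaF_val]
    generalize (sigmaChain n j _ x).val = y at chain_val ⊢
    split_ifs at chain_val ⊢ <;> omega

/-- STATEMENT 14: for `1 ≤ i ≤ j ≤ n+1`, one has
`(σ_2 ; σ_3 ; ⋯ ; σ_j) ; σ_{(i)} = σ_{(i+1)} ; σ_{(j+1)}` as permutations of `[n+2]`
(diagrammatic composition), and both sides equal the explicitly described map `φ`. -/
theorem chain_cycle_identity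
    (n i j : ℕ) (hi : 1 ≤ i) (hij : i ≤ j) (hj : j ≤ n + 1) :
    let φ : Fin (n + 2) → Fin (n + 2) := fun x =>
      if x.val = 0 then ⟨i - 1, by omega⟩
      else if x.val = 1 then ⟨j, by omega⟩
      else if x.val ≤ i then ⟨x.val - 2, by have := x.isLt; omega⟩
      else if x.val ≤ j then ⟨x.val - 1, by have := x.isLt; omega⟩
      else x
    sigmaCycleF (n + 2) i (by omega) (by omega) ∘ sigmaChain (n + 2) j (by omega)
      = sigmaCycleF (n + 2) (j + 1) (by omega) (by omega)
          ∘ sigmaCycleF (n + 2) (i + 1) (by omega) (by omega)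
    ∧ sigmaCycleF (n + 2) i (by omega) (by omega) ∘ sigmaChain (n + 2) j (by omega) = φ
    ∧ sigmaCycleF (n + 2) (j + 1) (by omega) (by omega)
        ∘ sigmaCycleF (n + 2) (i + 1) (by omega) (by omega) = φ := by
  intro φ
  have chain_eq : sigmaCycleF (n + 2) i (by omega) (by omega) ∘
      sigmaChain (n + 2) j (by omega) = φ := by
    funext x
    apply Fin.ext
    simp only [Function.comp_apply, sigmaCycleF_val, sigmaChain_val _ _ (hi.trans hij), φ,
      apply_ite Fin.val]
    split_ifs <;> omega
  have cycle_eq : sigmaCycleF (n + 2) (j + 1) (by omega) (by omega) ∘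
      sigmaCycleF (n + 2) (i + 1) (by omega) (by omega) = φ := by
    funext x
    apply Fin.ext
    simp only [Function.comp_apply, sigmaCycleF_val, φ, apply_ite Fin.val]
    split_ifs <;> omega
  exact ⟨chain_eq.trans cycle_eq.symm, chain_eq, cycle_eq⟩
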